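/- Let X be a complete separable median space of finite rank. Then every nonempty proper closed convex subset C ⊆ X is the intersection of a countable family of closed halfspaces of X containing C. -/

import Mathlib

open Set Metric MeasureTheory

/-- The metric interval `[a,b]` in a metric space. -/
def mInterval {X : Type*} [MetricSpace X] (a b : X) : Set X :=
  {c : X | dist a b = dist a c + dist c b}

/-- A median space: each triple of points has a unique median point. -/
def IsMedianSpace (X : Type*) [MetricSpace X] : Prop :=
  ∀ x y z : X, ∃! m : X, m ∈ mInterval x y ∧ m ∈ mInterval x z ∧ m ∈ mInterval y z

/-- Convexity with respect to metric intervals. -/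
def MedConvex {X : Type*} [MetricSpace X] (C : Set X) : Prop :=
  ∀ a ∈ C, ∀ b ∈ C, mInterval a b ⊆ C

/-- A halfspace: a subset such that it and its complement are convex. -/
def IsHalfspace {X : Type*} [MetricSpace X] (h : Set X) : Prop :=
  MedConvex h ∧ MedConvex hᶜ

/-- Two halfspaces are transverse. -/
def Transverse {X : Type*} [MetricSpace X] (h₁ h₂ : Set X) : Prop :=
  (h₁ ∩ h₂).Nonempty ∧ (h₁ ∩ h₂ᶜ).Nonempty ∧ (h₁ᶜ ∩ h₂).Nonempty ∧ (h₁ᶜ ∩ h₂ᶜ).Nonempty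

/-- Finite rank: a uniform bound on families of pairwise transverse halfspaces. -/
def HasFiniteRank (X : Type*) [MetricSpace X] : Prop :=
  ∃ n : ℕ, ∀ H : Set (Set X), (∀ h ∈ H, IsHalfspace h) → H.Pairwise Transverse →
    H.Finite ∧ H.ncard ≤ n

namespace MedAux

variable {X : Type*} [MetricSpace X]

lemma mem_iff {a b c : X} : c ∈ mInterval a b ↔ dist a b = dist a c + dist c b := Iff.rfl

lemma sym {a b c : X} (h : c ∈ mInterval a b) : c ∈ mInterval b a := by
  rw [mem_iff] at *
  rw [dist_comm b a, dist_comm b c, dist_comm c a]; linarith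

lemma left (a b : X) : a ∈ mInterval a b := by simp [mem_iff]

lemma right (a b : X) : b ∈ mInterval a b := by simp [mem_iff]

lemma tr1 {a b x y : X} (hx : x ∈ mInterval a b) (hy : y ∈ mInterval a x) :
    y ∈ mInterval a b := by
  rw [mem_iff] at *
  linarith [dist_triangle y x b, dist_triangle a y b]

lemma tr2 {a b x y : X} (hx : x ∈ mInterval a b) (hy : y ∈ mInterval a x) :
    x ∈ mInterval y b := by
  rw [mem_iff] at *
  linarith [dist_triangle y x b, dist_triangle a y b]

/-- symmetric version of `tr1`. -/
lemma tr1s {a b x y : X} (hx : x ∈ mInterval a b) (hy : y ∈ mInterval x b) :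
    y ∈ mInterval a b := sym (tr1 (sym hx) (sym hy))

lemma tr2s {a b x y : X} (hx : x ∈ mInterval a b) (hy : y ∈ mInterval x b) :
    x ∈ mInterval a y := sym (tr2 (sym hx) (sym hy))

lemma anti {a x y : X} (hx : x ∈ mInterval a y) (hy : y ∈ mInterval a x) : x = y := by
  rw [mem_iff] at *
  rw [dist_comm y x] at hy
  exact dist_le_zero.1 (by linarith)

lemma degen {a b : X} (h : b ∈ mInterval a a) : b = a := by
  rw [mem_iff, dist_self, dist_comm b a] at h
  exact (dist_le_zero.1 (by linarith [@dist_nonneg _ _ a b])).symm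



noncomputable def med (hmed : IsMedianSpace X) (x y z : X) : X := (hmed x y z).choose

lemma med12 (hmed : IsMedianSpace X) (x y z : X) : med hmed x y z ∈ mInterval x y := (hmed x y z).choose_spec.1.1
lemma med13 (hmed : IsMedianSpace X) (x y z : X) : med hmed x y z ∈ mInterval x z := (hmed x y z).choose_spec.1.2.1
lemma med23 (hmed : IsMedianSpace X) (x y z : X) : med hmed x y z ∈ mInterval y z := (hmed x y z).choose_spec.1.2.2

lemma med_uniq (hmed : IsMedianSpace X) {x y z m : X} (h1 : m ∈ mInterval x y) (h2 : m ∈ mInterval x z)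
    (h3 : m ∈ mInterval y z) : m = med hmed x y z :=
  (hmed x y z).choose_spec.2 m ⟨h1, h2, h3⟩

/-- gate property of intervals. -/
lemma gate (hmed : IsMedianSpace X) {a b x : X} (z : X) (hx : x ∈ mInterval a b) :
    med hmed a b z ∈ mInterval x z := by
  set p := med hmed a x z with hp
  set q := med hmed x b z with hq
  set m := med hmed p q z with hm
  have hpax : p ∈ mInterval a x := med12 hmed a x z
  have hqxb : q ∈ mInterval x b := med12 hmed x b z
  have hpz : p ∈ mInterval a z := med13 hmed a x z
  have hqz : q ∈ mInterval b z := med23 hmed x b z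
  have hpxz : p ∈ mInterval x z := med23 hmed a x z
  have hpab : p ∈ mInterval a b := tr1 hx hpax
  have hxpb : x ∈ mInterval p b := tr2 hx hpax
  have hqpb : q ∈ mInterval p b := tr1s hxpb hqxb
  have hm1 : m ∈ mInterval p q := med12 hmed p q z
  have hm2 : m ∈ mInterval p z := med13 hmed p q z
  have hm3 : m ∈ mInterval q z := med23 hmed p q z
  have hmab : m ∈ mInterval a b := tr1s hpab (tr1 hqpb hm1)
  have e : m = med hmed a b z := med_uniq hmed hmab (tr1s hpz hm2) (tr1s hqz hm3)
  rw [← e]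
  exact tr1s hpxz hm2

lemma conv_interval (hmed : IsMedianSpace X) (a b : X) : MedConvex (mInterval a b) := by
  intro x hx y hy z hz
  have h1 := gate hmed z hx
  have h2 := gate hmed z hy
  have h3 := med12 hmed a b z
  have : z = med hmed a b z := by
    rw [mem_iff] at h1 h2 hz
    apply dist_le_zero.1
    rw [dist_comm z y] at hz
    have := dist_triangle x (med hmed a b z) y
    rw [dist_comm (med hmed a b z) y] at this
    rw [dist_comm z _]
    linarith
  rw [this]; exact h3

lemma lip (hmed : IsMedianSpace X) (a b z w : X) : dist (med hmed a b z) (med hmed a b w) ≤ dist z w := by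
  have h1 := gate hmed z (med12 hmed a b w)
  have h2 := gate hmed w (med12 hmed a b z)
  rw [mem_iff] at h1 h2
  set u := med hmed a b z
  set v := med hmed a b w
  rw [dist_comm v u] at h1
  linarith [dist_triangle v w z, dist_triangle u z w, dist_comm z w]

/-- The sublemma. -/
lemma sub (hmed : IsMedianSpace X) {w y a t u : X} (h1 : t ∈ mInterval w y) (h2 : t ∈ mInterval w a)
    (hu : u ∈ mInterval a y) : t ∈ mInterval w u := by
  have s1 := med12 hmed a y t
  have s2 := med13 hmed a y t
  have s3 := med23 hmed a y t
  have e := med_uniq hmed s1 (tr1 (sym h2) s2) (tr1 (sym h1) s3)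
  have h5 := tr2 (sym h2) s2
  rw [e] at h5
  exact sym (tr1s (gate hmed w hu) h5)

lemma pasch (hmed : IsMedianSpace X) {a y z c w : X} (hc : c ∈ mInterval a y) (hw : w ∈ mInterval z y) :
    ∃ g, g ∈ mInterval c z ∧ g ∈ mInterval w a := by
  refine ⟨med hmed c z w, med12 hmed c z w, ?_⟩
  set g := med hmed c z w
  have g1 : g ∈ mInterval c w := med13 hmed c z w
  have g2 : g ∈ mInterval z w := med23 hmed c z w
  have hwg : w ∈ mInterval g y := tr2 hw g2
  set g' := med hmed w a g
  have k1 : g' ∈ mInterval w a := med12 hmed w a g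
  have k2 : g' ∈ mInterval w g := med13 hmed w a g
  have k3 : g' ∈ mInterval a g := med23 hmed w a g
  have k4 : g' ∈ mInterval g c := sub hmed (tr1 hwg (sym k2)) (sym k3) hc
  have k5 : g ∈ mInterval c g' := tr2s g1 (sym k2)
  rw [anti k5 (sym k4)]; exact k1

def joinPt (A : Set X) (y : X) : Set X := {u | ∃ a ∈ A, u ∈ mInterval a y}

lemma join_conv (hmed : IsMedianSpace X) {A : Set X} (hA : MedConvex A) (y : X) : MedConvex (joinPt A y) := by
  rintro u ⟨a1, ha1, hu⟩ v ⟨a2, ha2, hv⟩ w hw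
  set a3 := med hmed a1 a2 w
  refine ⟨a3, hA a1 ha1 a2 ha2 (med12 hmed a1 a2 w), ?_⟩
  have b1 : a3 ∈ mInterval a1 w := med13 hmed a1 a2 w
  have b2 : a3 ∈ mInterval a2 w := med23 hmed a1 a2 w
  set t := med hmed a3 y w
  have t1 : t ∈ mInterval a3 y := med12 hmed a3 y w
  have t2 : t ∈ mInterval a3 w := med13 hmed a3 y w
  have t3 : t ∈ mInterval y w := med23 hmed a3 y w
  have h1 : t ∈ mInterval w u := sub hmed (sym t3) (sym (tr1s b1 t2)) hu
  have h2 : t ∈ mInterval w v := sub hmed (sym t3) (sym (tr1s b2 t2)) hv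
  have h3 : w ∈ mInterval u t := tr2s hw h2
  rw [anti h3 (sym h1)]; exact t1

/-- maximal convex set disjoint from `C`. -/
lemma exists_max {A C : Set X} (hA : MedConvex A) (hAC : Disjoint A C) :
    ∃ h, A ⊆ h ∧ MedConvex h ∧ Disjoint h C ∧
      ∀ h', MedConvex h' → Disjoint h' C → h ⊆ h' → h' ⊆ h := by
  obtain ⟨h, hAh, hm⟩ := zorn_subset_nonempty {h : Set X | MedConvex h ∧ Disjoint h C} (by
    intro c hc hch hne
    refine ⟨⋃₀ c, ⟨?_, ?_⟩, fun s hs => subset_sUnion_of_mem hs⟩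
    · rintro a ⟨s, hs, has⟩ b ⟨t, ht, hbt⟩
      rcases hch.total hs ht with h | h
      · exact ((hc ht).1 a (h has) b hbt).trans (subset_sUnion_of_mem ht)
      · exact ((hc hs).1 a has b (h hbt)).trans (subset_sUnion_of_mem hs)
    · rw [disjoint_sUnion_left]
      exact fun s hs => (hc hs).2) A ⟨hA, hAC⟩
  exact ⟨h, hAh, hm.prop.1, hm.prop.2, fun h' h1 h2 h3 => hm.le_of_ge ⟨h1, h2⟩ h3⟩

lemma max_meets (hmed : IsMedianSpace X) {C h : Set X} (hne : h.Nonempty) (hh : MedConvex h)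
    (hmax : ∀ h', MedConvex h' → Disjoint h' C → h ⊆ h' → h' ⊆ h) {y : X} (hy : y ∉ h) :
    ∃ a ∈ h, ∃ c ∈ C, c ∈ mInterval a y := by
  by_contra hcon
  push Not at hcon
  obtain ⟨a, ha⟩ := hne
  refine hy (hmax (joinPt h y) (join_conv hmed hh y) ?_ ?_ ⟨a, ha, right a y⟩)
  · rw [Set.disjoint_left]
    rintro u ⟨b, hb, hu⟩ huC
    exact hcon b hb u huC hu
  · exact fun b hb => ⟨b, hb, left b y⟩

lemma max_half (hmed : IsMedianSpace X) {C h : Set X} (hC : MedConvex C) (hne : h.Nonempty) (hh : MedConvex h)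
    (hd : Disjoint h C)
    (hmax : ∀ h', MedConvex h' → Disjoint h' C → h ⊆ h' → h' ⊆ h) : IsHalfspace h := by
  refine ⟨hh, ?_⟩
  intro y hy z hz w hw hwh
  obtain ⟨a1, ha1, c1, hc1, h1⟩ := max_meets hmed hne hh hmax hy
  obtain ⟨a2, ha2, c2, hc2, h2⟩ := max_meets hmed hne hh hmax hz
  obtain ⟨d, hd1, hd2⟩ := pasch hmed h1 (sym hw)
  have hdh : d ∈ h := hh w hwh a1 ha1 hd2
  obtain ⟨e, he1, he2⟩ := pasch hmed h2 hd1
  exact Set.disjoint_left.1 hd (hh d hdh a2 ha2 he2) (hC c2 hc2 c1 hc1 he1)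

lemma separate (hmed : IsMedianSpace X) {A C : Set X} (hA : MedConvex A) (hC : MedConvex C) (hne : A.Nonempty)
    (hAC : Disjoint A C) : ∃ h, IsHalfspace h ∧ A ⊆ h ∧ Disjoint h C := by
  obtain ⟨h, h1, h2, h3, h4⟩ := exists_max hA hAC
  exact ⟨h, max_half hmed hC (hne.mono h1) h2 h3 h4, h1, h3⟩

lemma exists_gate (hmed : IsMedianSpace X) [CompleteSpace X] {C : Set X} (hC : MedConvex C) (hcl : IsClosed C)
    (hne : C.Nonempty) (x : X) : ∃ c ∈ C, ∀ y ∈ C, c ∈ mInterval x y := by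
  set D := Metric.infDist x C
  have hD : ∀ y ∈ C, D ≤ dist x y := fun y hy => Metric.infDist_le_dist_of_mem hy
  have hex : ∀ n : ℕ, ∃ y ∈ C, dist x y < D + 1 / ((n : ℝ) + 1) := fun n =>
    (Metric.infDist_lt_iff hne).1 (by have : 0 < 1 / ((n : ℝ) + 1) := by positivity
                                      linarith)
  choose s hs hsd using hex
  have key : ∀ u ∈ C, ∀ v ∈ C, dist u v ≤ dist x u + dist x v - 2 * D := by
    intro u hu v hv
    have h1 := med12 hmed x u v
    have h2 := med13 hmed x u v
    have h3 := med23 hmed x u v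
    have h4 := hD _ (hC u hu v hv h3)
    rw [mem_iff] at h1 h2 h3
    linarith [dist_comm u (med hmed x u v)]
  have hlim : Filter.Tendsto (fun n : ℕ => 1 / ((n : ℝ) + 1)) Filter.atTop (nhds 0) :=
    tendsto_one_div_add_atTop_nhds_zero_nat
  have hcau : CauchySeq s := by
    refine cauchySeq_of_le_tendsto_0 (fun n : ℕ => 2 * (1 / ((n : ℝ) + 1))) ?_ ?_
    · intro n m N hn hm
      have h1 := key _ (hs n) _ (hs m)
      have e1 := hsd n
      have e2 := hsd m
      have e3 := Nat.one_div_le_one_div (α := ℝ) hn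
      have e4 := Nat.one_div_le_one_div (α := ℝ) hm
      linarith
    · simpa using hlim.const_mul 2
  obtain ⟨c, hc⟩ := cauchySeq_tendsto_of_complete hcau
  have hcC : c ∈ C := hcl.mem_of_tendsto hc (Filter.Eventually.of_forall hs)
  have hcD : dist x c ≤ D := by
    have h1 : Filter.Tendsto (fun n => dist x (s n)) Filter.atTop (nhds (dist x c)) :=
      tendsto_const_nhds.dist hc
    have h2 : Filter.Tendsto (fun n : ℕ => D + 1 / ((n : ℝ) + 1)) Filter.atTop (nhds (D + 0)) :=
      tendsto_const_nhds.add hlim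
    rw [add_zero] at h2
    exact le_of_tendsto_of_tendsto' h1 h2 (fun n => (hsd n).le)
  refine ⟨c, hcC, fun y hy => ?_⟩
  have h1 := med12 hmed x c y
  have h2 := med13 hmed x c y
  have h4 := hD _ (hC c hcC y hy (med23 hmed x c y))
  have : med hmed x c y = c := by
    rw [mem_iff] at h1
    exact dist_le_zero.1 (by linarith)
  rwa [this] at h2

/-- one step of the construction of transverse halfspaces. -/
lemma step (hmed : IsMedianSpace X) {a c e y : X} {h : Set X} (hh : IsHalfspace h)
    (hY : ∀ δ > 0, ∃ y ∈ mInterval a c, y ∉ h ∧ dist a y < δ)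
    (hE : ∀ δ > 0, ∃ e ∈ mInterval a c, e ∈ h ∧ dist e c < δ)
    (hah : a ∈ h) (hy : y ∈ mInterval a c) (hyh : y ∉ h)
    (he : e ∈ mInterval a c) (heh : e ∈ h) :
    ∃ (e' y' : X) (P : Set X), (e' ∈ mInterval a c ∧ e' ∈ h) ∧ (y' ∈ mInterval a c ∧ y' ∉ h) ∧
      e' ∈ mInterval e c ∧ y' ∈ mInterval a y ∧ IsHalfspace P ∧
      a ∈ P ∧ e ∈ P ∧ y' ∈ P ∧ c ∉ P ∧ y ∉ P ∧ e' ∉ P := by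
  set u := med hmed a e y with hu
  have u1 : u ∈ mInterval a e := med12 hmed a e y
  have u2 : u ∈ mInterval a y := med13 hmed a e y
  have u3 : u ∈ mInterval e y := med23 hmed a e y
  have huh : u ∈ h := hh.1 a hah e heh u1
  have huy : 0 < dist u y := dist_pos.2 (fun q => hyh (q ▸ huh))
  obtain ⟨y0, hy0, hy0h, hy0d⟩ := hY (dist u y / 2) (by linarith)
  obtain ⟨e0, he0, he0h, he0d⟩ := hE (dist u y / 2) (by linarith)
  set y' := med hmed a y y0
  set e' := med hmed c e e0
  have y1 : y' ∈ mInterval a y := med12 hmed a y y0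
  have y2 : y' ∈ mInterval a y0 := med13 hmed a y y0
  have y3 : y' ∈ mInterval y y0 := med23 hmed a y y0
  have e1 : e' ∈ mInterval c e := med12 hmed c e e0
  have e2 : e' ∈ mInterval c e0 := med13 hmed c e e0
  have e3 : e' ∈ mInterval e e0 := med23 hmed c e e0
  have hyd : dist a y' < dist u y / 2 := by
    rw [mem_iff] at y2
    linarith [@dist_nonneg _ _ y' y0]
  have hed : dist e' c < dist u y / 2 := by
    rw [mem_iff] at e2
    linarith [@dist_nonneg _ _ e' e0, dist_comm c e0, dist_comm c e']
  set u' := med hmed u y y'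
  set w' := med hmed u y e'
  have eu : u = med hmed u y a := med_uniq hmed (left _ _) (left _ _) (sym u2)
  have ey : y = med hmed u y c :=
    med_uniq hmed (right _ _) (tr2 hy u2) (left _ _)
  have hdu : dist u u' < dist u y / 2 := by
    have := lip hmed u y a y'
    rw [← eu] at this
    exact this.trans_lt hyd
  have hdw : dist w' y < dist u y / 2 := by
    have := lip hmed u y e' c
    rw [← ey] at this
    exact this.trans_lt hed
  obtain ⟨P, hP, hP1, hP2⟩ := separate hmed (conv_interval hmed u u') (conv_interval hmed w' y)
    ⟨u, left _ _⟩ (by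
      rw [Set.disjoint_left]
      intro z hz1 hz2
      rw [mem_iff] at hz1 hz2
      linarith [dist_triangle u z y, @dist_nonneg _ _ z u', @dist_nonneg _ _ w' z])
  have Pu : u ∈ P := hP1 (left _ _)
  have Pu' : u' ∈ P := hP1 (right _ _)
  have Py : y ∉ P := fun q => Set.disjoint_left.1 hP2 q (right _ _)
  have Pw' : w' ∉ P := fun q => Set.disjoint_left.1 hP2 q (left _ _)
  have Pa : a ∈ P := by
    by_contra q
    exact hP.2 a q y Py u2 Pu
  have Pe : e ∈ P := by
    by_contra q
    exact hP.2 e q y Py u3 Pu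
  have Py' : y' ∈ P := by
    by_contra q
    exact hP.2 y Py y' q (med23 hmed u y y') Pu'
  refine ⟨e', y', P, ⟨tr1s he (sym e1), hh.1 e heh e0 he0h e3⟩,
    ⟨tr1 hy y1, hh.2 y hyh y0 hy0h y3⟩, sym e1, y1, hP, Pa, Pe, Py', ?_, Py, ?_⟩
  · exact fun q => Py (hP.1 a Pa c q hy)
  · exact fun q => Pw' (hP.1 u Pu e' q (med13 hmed u y e'))

lemma no_seq (hmed : IsMedianSpace X) (hrank : HasFiniteRank X) {a c : X} {h : Set X} (hh : IsHalfspace h)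
    (hY : ∀ δ > 0, ∃ y ∈ mInterval a c, y ∉ h ∧ dist a y < δ)
    (hE : ∀ δ > 0, ∃ e ∈ mInterval a c, e ∈ h ∧ dist e c < δ)
    (hah : a ∈ h) : False := by
  let St := {p : X × X // (p.1 ∈ mInterval a c ∧ p.1 ∈ h) ∧ (p.2 ∈ mInterval a c ∧ p.2 ∉ h)}
  have hst : ∀ s : St, ∃ (s' : St) (P : Set X), s'.1.1 ∈ mInterval s.1.1 c ∧
      s'.1.2 ∈ mInterval a s.1.2 ∧ IsHalfspace P ∧
      a ∈ P ∧ s.1.1 ∈ P ∧ s'.1.2 ∈ P ∧ c ∉ P ∧ s.1.2 ∉ P ∧ s'.1.1 ∉ P := by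
    rintro ⟨⟨e, y⟩, ⟨he, heh⟩, ⟨hy, hyh⟩⟩
    obtain ⟨e', y', P, h1, h2, h3⟩ := step hmed hh hY hE hah hy hyh he heh
    exact ⟨⟨⟨e', y'⟩, h1, h2⟩, P, h3⟩
  choose nx Q hQ1 hQ2 hQ3 hQ4 hQ5 hQ6 hQ7 hQ8 hQ9 using hst
  obtain ⟨y0, hy0, hy0h, -⟩ := hY 1 one_pos
  obtain ⟨e0, he0, he0h, -⟩ := hE 1 one_pos
  let s0 : St := ⟨⟨e0, y0⟩, ⟨he0, he0h⟩, ⟨hy0, hy0h⟩⟩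
  let sq : ℕ → St := fun n => nx^[n] s0
  have hsq : ∀ n, sq (n + 1) = nx (sq n) := fun n => Function.iterate_succ_apply' nx n s0
  let P : ℕ → Set X := fun n => Q (sq n)
  have hin : ∀ i k, (sq (i + 1 + k)).1.2 ∈ P i := by
    intro i k
    induction k with
    | zero => rw [add_zero, hsq]; exact hQ6 _
    | succ k ih =>
      rw [← add_assoc, hsq]
      exact (hQ3 (sq i)).1 a (hQ4 _) _ ih (hQ2 _)
  have hout : ∀ i k, (sq (i + 1 + k)).1.1 ∉ P i := by
    intro i k
    induction k with
    | zero => rw [add_zero, hsq]; exact hQ9 _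
    | succ k ih =>
      rw [← add_assoc, hsq]
      exact (hQ3 (sq i)).2 _ ih c (hQ7 _) (hQ1 _)
  have hA : ∀ i j, i < j → (P i ∩ (P j)ᶜ).Nonempty ∧ ((P i)ᶜ ∩ P j).Nonempty := by
    intro i j hij
    obtain ⟨k, rfl⟩ := Nat.exists_eq_add_of_le (Nat.succ_le_of_lt hij)
    exact ⟨⟨_, hin i k, hQ8 _⟩, ⟨_, hout i k, hQ5 _⟩⟩
  have hT : ∀ i j, i ≠ j → Transverse (P i) (P j) := by
    intro i j hij
    refine ⟨⟨a, hQ4 _, hQ4 _⟩, ?_, ?_, ⟨c, hQ7 _, hQ7 _⟩⟩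
    · rcases lt_or_gt_of_ne hij with q | q
      · exact (hA i j q).1
      · rw [Set.inter_comm]; exact (hA j i q).2
    · rcases lt_or_gt_of_ne hij with q | q
      · exact (hA i j q).2
      · rw [Set.inter_comm]; exact (hA j i q).1
  have hinj : Function.Injective P := by
    intro i j hP
    by_contra hij
    obtain ⟨z, hz1, hz2⟩ := (hT i j hij).2.1
    exact hz2 (hP ▸ hz1)
  obtain ⟨n, hn⟩ := hrank
  refine Set.infinite_range_of_injective hinj (hn (Set.range P) ?_ ?_).1
  · rintro _ ⟨i, rfl⟩
    exact hQ3 _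
  · rintro _ ⟨i, rfl⟩ _ ⟨j, rfl⟩ hij
    exact hT i j (fun q => hij (q ▸ rfl))

lemma max_open (hmed : IsMedianSpace X) [CompleteSpace X] (hrank : HasFiniteRank X) {C h : Set X} (hC : MedConvex C)
    (hcl : IsClosed C) (hCne : C.Nonempty) (hh : IsHalfspace h)
    (hd : Disjoint h C)
    (hmax : ∀ h', MedConvex h' → Disjoint h' C → h ⊆ h' → h' ⊆ h) : IsOpen h := by
  rw [Metric.isOpen_iff]
  intro a ha
  by_contra hcon
  have hy : ∀ δ > 0, ∃ y, y ∉ h ∧ dist a y < δ := by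
    intro δ hδ
    by_contra q
    push Not at q
    refine hcon ⟨δ, hδ, fun y hy => ?_⟩
    by_contra hyh
    rw [Metric.mem_ball, dist_comm] at hy
    exact absurd hy (not_lt.2 (q y hyh))
  obtain ⟨c, hcC, hc⟩ := exists_gate hmed hC hcl hCne a
  have hch : c ∉ h := fun q => Set.disjoint_left.1 hd q hcC
  refine no_seq hmed hrank (a := a) (c := c) hh ?_ ?_ ha
  · intro δ hδ
    obtain ⟨y, hyh, hyd⟩ := hy δ hδ
    refine ⟨med hmed a c y, med12 hmed a c y, hh.2 c hch y hyh (med23 hmed a c y), ?_⟩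
    have := med13 hmed a c y
    rw [mem_iff] at this
    linarith [@dist_nonneg _ _ (med hmed a c y) y]
  · intro δ hδ
    obtain ⟨y, hyh, hyd⟩ := hy δ hδ
    obtain ⟨a', ha', c', hc', hca⟩ := max_meets hmed ⟨a, ha⟩ hh.1 hmax hyh
    have hb := med13 hmed a' c' a
    have hbd := lip hmed a' c' a y
    have e1 : c' = med hmed a' c' y := med_uniq hmed (right _ _) hca (left _ _)
    rw [← e1] at hbd
    set b := med hmed a' c' a
    have hbh : b ∈ h := hh.1 a' ha' a ha hb
    have hed := lip hmed a c b c'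
    have e2 : c = med hmed a c c' := med_uniq hmed (right _ _) (hc c' hc') (left _ _)
    rw [← e2] at hed
    exact ⟨med hmed a c b, med12 hmed a c b, hh.1 a ha b hbh (med13 hmed a c b), by linarith⟩

end MedAux

theorem stmt12 {X : Type*} [MetricSpace X] [CompleteSpace X]
    [TopologicalSpace.SeparableSpace X]
    (hmed : IsMedianSpace X) (hrank : HasFiniteRank X)
    (C : Set X) (hCne : C.Nonempty) (hCproper : C ≠ Set.univ)
    (hCcl : IsClosed C) (hCcv : MedConvex C) :
    ∃ S : Set (Set X), S.Countable ∧
      (∀ h ∈ S, IsHalfspace h ∧ IsClosed h ∧ C ⊆ h) ∧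
      C = ⋂₀ S := by
  have : SecondCountableTopology X := UniformSpace.secondCountable_of_separable X
  let T : Set (Set X) := {U | IsHalfspace U ∧ IsOpen U ∧ Disjoint U C}
  obtain ⟨T', hT'c, hT'T, hT'⟩ := TopologicalSpace.isOpen_sUnion_countable T (fun U hU => hU.2.1)
  have hcov : ⋃₀ T = Cᶜ := by
    apply Set.Subset.antisymm
    · exact Set.sUnion_subset fun U hU => hU.2.2.subset_compl_right
    · intro x hx
      have hxc : MedConvex ({x} : Set X) := by
        rintro a rfl b rfl z hz
        exact MedAux.degen hz
      obtain ⟨h, h1, h2, h3, h4⟩ := MedAux.exists_max hxc (Set.disjoint_singleton_left.2 hx)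
      have hh := MedAux.max_half hmed hCcv ⟨x, h1 rfl⟩ h2 h3 h4
      exact ⟨h, ⟨hh, MedAux.max_open hmed hrank hCcv hCcl hCne hh h3 h4, h3⟩, h1 rfl⟩
  refine ⟨compl '' T', hT'c.image _, ?_, ?_⟩
  · rintro _ ⟨U, hU, rfl⟩
    obtain ⟨h1, h2, h3⟩ := hT'T hU
    exact ⟨⟨h1.2, by rw [compl_compl]; exact h1.1⟩, h2.isClosed_compl, h3.subset_compl_left⟩
  · rw [← Set.compl_sUnion, hT', hcov, compl_compl]
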